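/- Let s₂ > 2 and s₁ ≥ s₂. Then there exists a constant c > 0 such that for every real-valued Schwartz function u on ℝ², | ⟨u, u ∂ₓu⟩_{L²(ℝ²)} + ⟨J_x^{s₁} u, J_x^{s₁}(u ∂ₓu)⟩_{L²(ℝ²)} + ⟨J_y^{s₂} u, J_y^{s₂}(u ∂ₓu)⟩_{L²(ℝ²)} | ≤ c ‖u‖_{s₁,s₂}³, where ‖u‖²_{s₁,s₂} = ‖u‖_{L²}² + ‖J_x^{s₁} u‖_{L²}² + ‖J_y^{s₂} u‖_{L²}². -/

import Mathlib

open MeasureTheory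

/-- The Fourier transform on `ℝ²`: `f̂(ξ,η) = ∫ e^{−i(xξ+yη)} f(x,y) dx dy`. -/
noncomputable def FT2 (f : ℝ × ℝ → ℂ) (q : ℝ × ℝ) : ℂ :=
  ∫ p : ℝ × ℝ, Complex.exp (-(Complex.I * ((p.1 : ℂ) * (q.1 : ℂ) + (p.2 : ℂ) * (q.2 : ℂ)))) * f p

/-- `J_x^s`, the Bessel potential in the `x` variable:
`(J_x^s f)^(ξ,η) = (1+ξ²)^{s/2} f̂(ξ,η)`; realized by Fourier inversion. -/
noncomputable def Jx (s : ℝ) (f : ℝ × ℝ → ℂ) (p : ℝ × ℝ) : ℂ :=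
  ((1 / (2 * Real.pi) ^ 2 : ℝ) : ℂ) *
    ∫ q : ℝ × ℝ, Complex.exp (Complex.I * ((p.1 : ℂ) * (q.1 : ℂ) + (p.2 : ℂ) * (q.2 : ℂ))) *
      (((1 + q.1 ^ 2) ^ (s / 2) : ℝ) : ℂ) * FT2 f q

/-- `J_y^s`, the Bessel potential in the `y` variable:
`(J_y^s f)^(ξ,η) = (1+η²)^{s/2} f̂(ξ,η)`; realized by Fourier inversion. -/
noncomputable def Jy (s : ℝ) (f : ℝ × ℝ → ℂ) (p : ℝ × ℝ) : ℂ :=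
  ((1 / (2 * Real.pi) ^ 2 : ℝ) : ℂ) *
    ∫ q : ℝ × ℝ, Complex.exp (Complex.I * ((p.1 : ℂ) * (q.1 : ℂ) + (p.2 : ℂ) * (q.2 : ℂ))) *
      (((1 + q.2 ^ 2) ^ (s / 2) : ℝ) : ℂ) * FT2 f q

/-- The `L²(ℝ²)` inner product `⟨f,g⟩ = ∫ conj (f) g`. -/
noncomputable def IP2 (f g : ℝ × ℝ → ℂ) : ℂ :=
  ∫ p : ℝ × ℝ, (starRingEnd ℂ) (f p) * g p

/-- The `L²(ℝ²)` norm. -/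
noncomputable def L2norm2 (f : ℝ × ℝ → ℂ) : ℝ :=
  (∫ p : ℝ × ℝ, ‖f p‖ ^ 2) ^ ((1 : ℝ) / 2)

/-- The anisotropic `H^{s₁,s₂}` norm `(‖u‖² + ‖J_x^{s₁}u‖² + ‖J_y^{s₂}u‖²)^{1/2}`. -/
noncomputable def anisoNorm (s₁ s₂ : ℝ) (f : ℝ × ℝ → ℂ) : ℝ :=
  (L2norm2 f ^ 2 + L2norm2 (Jx s₁ f) ^ 2 + L2norm2 (Jy s₂ f) ^ 2) ^ ((1 : ℝ) / 2)



/-- Japanese bracket. -/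
noncomputable def br (t : ℝ) : ℝ := √(1 + t ^ 2)

lemma one_le_br (t : ℝ) : 1 ≤ br t := by
  unfold br
  rw [Real.one_le_sqrt]; nlinarith [sq_nonneg t]

lemma br_pos (t : ℝ) : 0 < br t := lt_of_lt_of_le one_pos (one_le_br t)

lemma br_sq (t : ℝ) : br t ^ 2 = 1 + t ^ 2 := by
  unfold br; rw [Real.sq_sqrt]; positivity

lemma abs_le_br (t : ℝ) : |t| ≤ br t := by
  unfold br; apply Real.abs_le_sqrt; linarith

lemma br_neg (t : ℝ) : br (-t) = br t := by simp [br]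

lemma br_mono {a b : ℝ} (h : |b| ≤ |a|) : br b ≤ br a := by
  unfold br; apply Real.sqrt_le_sqrt
  have := sq_le_sq.mpr h
  linarith

lemma br_rpow (t s : ℝ) : br t ^ s = (1 + t ^ 2) ^ (s / 2) := by
  unfold br
  rw [Real.sqrt_eq_rpow, ← Real.rpow_mul (by positivity)]
  congr 1; ring

lemma br_sub_le {a b c : ℝ} (habc : a + b + c = 0) : br a - br b ≤ |c| := by
  have h1 : br a ≤ br b + |c| := by
    unfold br
    rw [Real.sqrt_le_left (by positivity)]
    have hb := abs_le_br b
    have := br_sq b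
    have hc : a = -b - c := by linarith
    have : -(2 * b * -c) ≤ 2 * (br b * |c|) := by
      have : b * c ≤ br b * |c| := (le_abs_self _).trans (by rw [abs_mul]; gcongr)
      linarith
    change _ ≤ (br b + |c|) ^ 2
    have h3 := sq_abs c
    rw [hc]
    nlinarith
  linarith

lemma br_le_two {a b c : ℝ} (habc : a + b + c = 0) (hcb : |c| ≤ |b|) : br a ≤ 2 * br b := by
  unfold br
  rw [Real.sqrt_le_left (by positivity), mul_pow, Real.sq_sqrt (by positivity)]
  have h : |a| ≤ 2 * |b| := by
    have : a = -b - c := by linarith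
    rw [this]
    calc |-b - c| ≤ |-b| + |c| := abs_sub _ _
      _ ≤ _ := by rw [abs_neg]; linarith
  have : a ^ 2 ≤ (2 * b) ^ 2 := sq_le_sq.mpr (by rw [abs_mul]; simpa using h)
  nlinarith

lemma rpow_sub_le {x y p : ℝ} (hy : 0 < y) (hyx : y ≤ x) (hp : 1 ≤ p) :
    x ^ p - y ^ p ≤ p * x ^ (p - 1) * (x - y) := by
  have hx : 0 < x := hy.trans_le hyx
  have h := one_add_mul_self_le_rpow_one_add (s := y / x - 1) (by have := div_pos hy hx; linarith) hp
  rw [add_sub_cancel, Real.div_rpow hy.le hx.le] at h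
  have hxp : 0 < x ^ p := Real.rpow_pos_of_pos hx p
  have h1 : x ^ (p - 1) = x ^ p / x := by rw [Real.rpow_sub hx, Real.rpow_one]
  rw [h1]
  have h2 := mul_le_mul_of_nonneg_left h hxp.le
  rw [mul_div_cancel₀ _ hxp.ne'] at h2
  have : p * (x ^ p / x) * (x - y) = x ^ p - x ^ p * (1 + p * (y / x - 1)) := by
    field_simp; ring
  linarith

lemma core_mult {s : ℝ} (hs : 1 ≤ s) {a b c x y z : ℝ} (habc : a + b + c = 0) (hxyz : x + y + z = 0)
    (hcb : |c| ≤ |b|) (hba : |b| ≤ |a|) :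
    |x * (br a ^ s) ^ 2 + y * (br b ^ s) ^ 2 + z * (br c ^ s) ^ 2| ≤
      |z| * (br a ^ s * br b ^ s) + 2 * s * 2 ^ s * (|c| * (|x| * br a ^ (s - 1)) * br b ^ s) := by
  have hA := br_pos a
  have hB := br_pos b
  have hC := br_pos c
  have hBA := br_mono hba
  have hCB := br_mono hcb
  have e1 : x * (br a ^ s) ^ 2 + y * (br b ^ s) ^ 2 + z * (br c ^ s) ^ 2 =
    x * ((br a ^ s) ^ 2 - (br b ^ s) ^ 2) - z * ((br b ^ s) ^ 2 - (br c ^ s) ^ 2) := by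
    have : y = - x - z := by linarith
    rw [this]; ring
  have p1 : br b ^ s ≤ br a ^ s := Real.rpow_le_rpow hB.le hBA (by linarith)
  have p2 : br c ^ s ≤ br b ^ s := Real.rpow_le_rpow hC.le hCB (by linarith)
  have q1 : 0 < br a ^ s := Real.rpow_pos_of_pos hA _
  have q2 : 0 < br b ^ s := Real.rpow_pos_of_pos hB _
  have q3 : 0 < br c ^ s := Real.rpow_pos_of_pos hC _
  have sqr : ∀ t : ℝ, 0 < t → (t ^ s) ^ 2 = t ^ (2 * s) := by
    intro t ht
    rw [← Real.rpow_natCast, ← Real.rpow_mul ht.le]; congr 1; push_cast; ring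
  have d1 : (br a ^ s) ^ 2 - (br b ^ s) ^ 2 ≤ 2 * s * 2 ^ s * (|c| * br a ^ (s - 1) * br b ^ s) := by
    rw [sqr _ hA, sqr _ hB]
    have h1 := rpow_sub_le hB hBA (p := 2 * s) (by linarith)
    have h2 := br_sub_le habc
    have h3 : br a ^ (2 * s - 1) = br a ^ (s - 1) * br a ^ s := by
      rw [← Real.rpow_add hA]; congr 1; ring
    have h4 : br a ^ s ≤ 2 ^ s * br b ^ s := by
      rw [← Real.mul_rpow (by norm_num) hB.le]
      exact Real.rpow_le_rpow hA.le (br_le_two habc hcb) (by linarith)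
    have h5 : 0 < br a ^ (s - 1) := Real.rpow_pos_of_pos hA _
    calc _ ≤ _ := h1
      _ ≤ 2 * s * (br a ^ (s - 1) * (2 ^ s * br b ^ s)) * |c| := by
        rw [h3]; gcongr
      _ = _ := by ring
  rw [e1]
  calc _ ≤ |x * ((br a ^ s) ^ 2 - (br b ^ s) ^ 2)| + |z * ((br b ^ s) ^ 2 - (br c ^ s) ^ 2)| := abs_sub _ _
    _ = |x| * ((br a ^ s) ^ 2 - (br b ^ s) ^ 2) + |z| * ((br b ^ s) ^ 2 - (br c ^ s) ^ 2) := by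
      rw [abs_mul, abs_mul, abs_of_nonneg (sub_nonneg.mpr (pow_le_pow_left₀ q3.le p2 2)),
        abs_of_nonneg (sub_nonneg.mpr (pow_le_pow_left₀ q2.le p1 2))]
    _ ≤ |x| * (2 * s * 2 ^ s * (|c| * br a ^ (s - 1) * br b ^ s)) + |z| * (br a ^ s * br b ^ s) := by
      gcongr
      nlinarith
    _ = _ := by ring

lemma young_br {s₁ s₂ : ℝ} (hs₂ : 1 ≤ s₂) (hs₁ : s₂ ≤ s₁) (x a : ℝ) :
    |x| * br a ^ (s₂ - 1) ≤ br x ^ s₁ + br a ^ s₂ := by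
  have hx := br_pos x
  have ha := br_pos a
  have h0 : br x ^ s₂ ≤ br x ^ s₁ := Real.rpow_le_rpow_of_exponent_le (one_le_br x) hs₁
  have key : ∀ m : ℝ, 0 < m → m * m ^ (s₂ - 1) = m ^ s₂ := by
    intro m hm
    rw [Real.rpow_sub hm, Real.rpow_one]; field_simp
  have hx1 : 0 < br x ^ s₂ := Real.rpow_pos_of_pos hx _
  have ha1 : 0 < br a ^ s₂ := Real.rpow_pos_of_pos ha _
  have ha2 : 0 < br a ^ (s₂ - 1) := Real.rpow_pos_of_pos ha _
  rcases le_total (br x) (br a) with h | h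
  · calc _ ≤ br a * br a ^ (s₂ - 1) := by
          gcongr; exact (abs_le_br x).trans h
      _ = br a ^ s₂ := key _ ha
      _ ≤ _ := by linarith
  · calc _ ≤ br x * br x ^ (s₂ - 1) := by
          gcongr
          exact abs_le_br x
      _ = br x ^ s₂ := key _ hx
      _ ≤ _ := by linarith

/-- weight -/
noncomputable def Wt (s₁ s₂ x a : ℝ) : ℝ := br x ^ s₁ + br a ^ s₂

lemma Wt_pos (s₁ s₂ x a : ℝ) : 0 < Wt s₁ s₂ x a :=
  add_pos (Real.rpow_pos_of_pos (br_pos _) _) (Real.rpow_pos_of_pos (br_pos _) _)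

lemma le_Wt1 (s₁ s₂ x a : ℝ) : br x ^ s₁ ≤ Wt s₁ s₂ x a := by
  have := Real.rpow_pos_of_pos (br_pos a) s₂
  unfold Wt; linarith
lemma le_Wt2 (s₁ s₂ x a : ℝ) : br a ^ s₂ ≤ Wt s₁ s₂ x a := by
  have := Real.rpow_pos_of_pos (br_pos x) s₁
  unfold Wt; linarith

/-- the symmetric upper bound -/
noncomputable def SymB (s₁ s₂ x y z a b c : ℝ) : ℝ :=
  (|z| + |c|) * (Wt s₁ s₂ x a * Wt s₁ s₂ y b) + (|y| + |b|) * (Wt s₁ s₂ x a * Wt s₁ s₂ z c)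
   + (|x| + |a|) * (Wt s₁ s₂ y b * Wt s₁ s₂ z c)

lemma Sym_ge {s₁ s₂ x y z a b c : ℝ} :
  (|z| + |c|) * (Wt s₁ s₂ x a * Wt s₁ s₂ y b) ≤ SymB s₁ s₂ x y z a b c := by
  have h1 := Wt_pos s₁ s₂ x a
  have h2 := Wt_pos s₁ s₂ y b
  have h3 := Wt_pos s₁ s₂ z c
  unfold SymB
  have : 0 ≤ (|y| + |b|) * (Wt s₁ s₂ x a * Wt s₁ s₂ z c) := by positivity
  have : 0 ≤ (|x| + |a|) * (Wt s₁ s₂ y b * Wt s₁ s₂ z c) := by positivity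
  linarith

lemma sort3 {P : ℝ × ℝ → ℝ × ℝ → ℝ × ℝ → Prop} (f : ℝ × ℝ → ℝ)
    (h12 : ∀ p q r, P p q r → P q p r) (h23 : ∀ p q r, P p q r → P p r q)
    (h : ∀ p q r, f r ≤ f q → f q ≤ f p → P p q r) (p q r : ℝ × ℝ) : P p q r := by
  rcases le_total (f p) (f q) with h1 | h1 <;> rcases le_total (f q) (f r) with h2 | h2 <;>
    rcases le_total (f p) (f r) with h3 | h3
  · exact h12 _ _ _ (h23 _ _ _ (h12 _ _ _ (h r q p h1 h2)))
  · exact h12 _ _ _ (h23 _ _ _ (h12 _ _ _ (h r q p h1 h2)))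
  · exact h12 _ _ _ (h23 _ _ _ (h q r p h3 h2))
  · exact h12 _ _ _ (h q p r h3 h1)
  · exact h23 _ _ _ (h12 _ _ _ (h r p q h1 h3))
  · exact h23 _ _ _ (h p r q h2 h3)
  · exact h p q r h2 h1
  · exact h p q r h2 h1

lemma multY {s₁ s₂ : ℝ} (hs₂ : 1 ≤ s₂) (hs₁ : s₂ ≤ s₁) (p q r : ℝ × ℝ) :
    p.1 + q.1 + r.1 = 0 → p.2 + q.2 + r.2 = 0 →
    |p.1 * (br p.2 ^ s₂) ^ 2 + q.1 * (br q.2 ^ s₂) ^ 2 + r.1 * (br r.2 ^ s₂) ^ 2| ≤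
      (1 + 2 * s₂ * 2 ^ s₂) * SymB s₁ s₂ p.1 q.1 r.1 p.2 q.2 r.2 := by
  revert p q r
  refine sort3 (P := fun p q r => p.1 + q.1 + r.1 = 0 → p.2 + q.2 + r.2 = 0 →
    |p.1 * (br p.2 ^ s₂) ^ 2 + q.1 * (br q.2 ^ s₂) ^ 2 + r.1 * (br r.2 ^ s₂) ^ 2| ≤
      (1 + 2 * s₂ * 2 ^ s₂) * SymB s₁ s₂ p.1 q.1 r.1 p.2 q.2 r.2) (fun p => |p.2|) ?_ ?_ ?_
  · intro p q r h h1 h2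
    have := h (by linarith) (by linarith)
    unfold SymB at *
    convert this using 2 <;> ring
  · intro p q r h h1 h2
    have := h (by linarith) (by linarith)
    unfold SymB at *
    convert this using 2 <;> ring
  · intro p q r hrq hqp h1 h2
    have h := core_mult hs₂ h2 h1 hrq hqp
    refine h.trans (le_trans ?_ (mul_le_mul_of_nonneg_left Sym_ge (by positivity)))
    have w1 := young_br hs₂ hs₁ p.1 p.2
    have w2 := le_Wt2 s₁ s₂ p.1 p.2
    have w3 := le_Wt2 s₁ s₂ q.1 q.2
    have i1 := Wt_pos s₁ s₂ p.1 p.2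
    have i2 := Wt_pos s₁ s₂ q.1 q.2
    have j1 : 0 < br q.2 ^ s₂ := Real.rpow_pos_of_pos (br_pos _) _
    change _ ≤ Wt s₁ s₂ p.1 p.2 at w1
    calc _ ≤ |r.1| * (Wt s₁ s₂ p.1 p.2 * Wt s₁ s₂ q.1 q.2) + 2 * s₂ * 2 ^ s₂ * (|r.2| * Wt s₁ s₂ p.1 p.2 * Wt s₁ s₂ q.1 q.2) := by
          gcongr
      _ ≤ _ := by
        have : 0 ≤ Wt s₁ s₂ p.1 p.2 * Wt s₁ s₂ q.1 q.2 * |r.2| := by positivity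
        have : 0 ≤ Wt s₁ s₂ p.1 p.2 * Wt s₁ s₂ q.1 q.2 * |r.1| * (2 * s₂ * 2 ^ s₂) := by positivity
        linarith

lemma multX {s₁ s₂ : ℝ} (hs₁ : 1 ≤ s₁) (p q r : ℝ × ℝ) :
    p.1 + q.1 + r.1 = 0 → p.2 + q.2 + r.2 = 0 →
    |p.1 * (br p.1 ^ s₁) ^ 2 + q.1 * (br q.1 ^ s₁) ^ 2 + r.1 * (br r.1 ^ s₁) ^ 2| ≤
      (1 + 2 * s₁ * 2 ^ s₁) * SymB s₁ s₂ p.1 q.1 r.1 p.2 q.2 r.2 := by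
  revert p q r
  refine sort3 (P := fun p q r => p.1 + q.1 + r.1 = 0 → p.2 + q.2 + r.2 = 0 →
    |p.1 * (br p.1 ^ s₁) ^ 2 + q.1 * (br q.1 ^ s₁) ^ 2 + r.1 * (br r.1 ^ s₁) ^ 2| ≤
      (1 + 2 * s₁ * 2 ^ s₁) * SymB s₁ s₂ p.1 q.1 r.1 p.2 q.2 r.2) (fun p => |p.1|) ?_ ?_ ?_
  · intro p q r h h1 h2
    have := h (by linarith) (by linarith)
    unfold SymB at *
    convert this using 2 <;> ring
  · intro p q r h h1 h2
    have := h (by linarith) (by linarith)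
    unfold SymB at *
    convert this using 2 <;> ring
  · intro p q r hrq hqp h1 h2
    have h := core_mult hs₁ h1 h1 hrq hqp
    refine h.trans (le_trans ?_ (mul_le_mul_of_nonneg_left Sym_ge (by positivity)))
    have w1 : |p.1| * br p.1 ^ (s₁ - 1) ≤ br p.1 ^ s₁ := by
      have hm := br_pos p.1
      have : br p.1 ^ s₁ = br p.1 * br p.1 ^ (s₁ - 1) := by
        rw [Real.rpow_sub hm, Real.rpow_one]; field_simp
      rw [this]
      have := Real.rpow_pos_of_pos hm (s₁ - 1)
      gcongr; exact abs_le_br _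
    have w2 := le_Wt1 s₁ s₂ p.1 p.2
    have w3 := le_Wt1 s₁ s₂ q.1 q.2
    have i1 := Wt_pos s₁ s₂ p.1 p.2
    have i2 := Wt_pos s₁ s₂ q.1 q.2
    have j1 : 0 < br q.1 ^ s₁ := Real.rpow_pos_of_pos (br_pos _) _
    have w4 := w1.trans w2
    calc _ ≤ |r.1| * (Wt s₁ s₂ p.1 p.2 * Wt s₁ s₂ q.1 q.2) + 2 * s₁ * 2 ^ s₁ * (|r.1| * Wt s₁ s₂ p.1 p.2 * Wt s₁ s₂ q.1 q.2) := by
          gcongr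
      _ ≤ _ := by
        have : 0 ≤ Wt s₁ s₂ p.1 p.2 * Wt s₁ s₂ q.1 q.2 * |r.2| := by positivity
        have : 0 ≤ Wt s₁ s₂ p.1 p.2 * Wt s₁ s₂ q.1 q.2 * |r.2| * (2 * s₁ * 2 ^ s₁) := by positivity
        linarith

open MeasureTheory

/-- squared total weight -/
noncomputable def w2 (s₁ s₂ : ℝ) (z : ℂ) : ℝ :=
  1 + (br (2 * Real.pi * z.re) ^ s₁) ^ 2 + (br (2 * Real.pi * z.im) ^ s₂) ^ 2
noncomputable def wt (s₁ s₂ : ℝ) (z : ℂ) : ℝ := Wt s₁ s₂ (2 * Real.pi * z.re) (2 * Real.pi * z.im)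
noncomputable def ell (z : ℂ) : ℝ := |2 * Real.pi * z.re| + |2 * Real.pi * z.im|
noncomputable def mlt (s₁ s₂ : ℝ) (z : ℂ) : ℝ := 2 * Real.pi * z.re * w2 s₁ s₂ z

lemma br_cont : Continuous br := by unfold br; fun_prop

lemma brs_cont (s : ℝ) : Continuous (fun t => br t ^ s) :=
  br_cont.rpow_const (fun x => Or.inl (br_pos x).ne')

lemma w2_cont (s₁ s₂ : ℝ) : Continuous (w2 s₁ s₂) := by
  unfold w2
  have h1 := (brs_cont s₁).comp (g := fun t => br t ^ s₁) (f := fun z : ℂ => 2 * Real.pi * z.re) (by fun_prop)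
  have h2 := (brs_cont s₂).comp (g := fun t => br t ^ s₂) (f := fun z : ℂ => 2 * Real.pi * z.im) (by fun_prop)
  exact (continuous_const.add (h1.pow 2)).add (h2.pow 2)

lemma wt_cont (s₁ s₂ : ℝ) : Continuous (wt s₁ s₂) := by
  unfold wt Wt
  have h1 := (brs_cont s₁).comp (g := fun t => br t ^ s₁) (f := fun z : ℂ => 2 * Real.pi * z.re) (by fun_prop)
  have h2 := (brs_cont s₂).comp (g := fun t => br t ^ s₂) (f := fun z : ℂ => 2 * Real.pi * z.im) (by fun_prop)
  exact h1.add h2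

lemma ell_cont : Continuous ell := by unfold ell; fun_prop

lemma mlt_cont (s₁ s₂ : ℝ) : Continuous (mlt s₁ s₂) := by
  unfold mlt
  have := w2_cont s₁ s₂
  fun_prop

lemma w2_one_le (s₁ s₂ : ℝ) (z : ℂ) : 1 ≤ w2 s₁ s₂ z := by
  unfold w2
  nlinarith [sq_nonneg (br (2 * Real.pi * z.re) ^ s₁), sq_nonneg (br (2 * Real.pi * z.im) ^ s₂)]

lemma wt_sq_le (s₁ s₂ : ℝ) (z : ℂ) : wt s₁ s₂ z ^ 2 ≤ 2 * w2 s₁ s₂ z := by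
  unfold wt w2 Wt
  nlinarith [sq_nonneg (br (2 * Real.pi * z.re) ^ s₁ - br (2 * Real.pi * z.im) ^ s₂)]

lemma wt_pos (s₁ s₂ : ℝ) (z : ℂ) : 0 < wt s₁ s₂ z := Wt_pos _ _ _ _
lemma ell_nonneg (z : ℂ) : 0 ≤ ell z := by unfold ell; positivity

lemma w2_neg (s₁ s₂ : ℝ) (z : ℂ) : w2 s₁ s₂ (-z) = w2 s₁ s₂ z := by
  simp [w2, br_neg]

lemma mlt_bound {s₁ s₂ : ℝ} (hs₂ : 1 ≤ s₂) (hs₁ : s₂ ≤ s₁) : ∃ C : ℝ, 0 < C ∧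
    ∀ x y z : ℂ, x + y + z = 0 → |mlt s₁ s₂ x + mlt s₁ s₂ y + mlt s₁ s₂ z| ≤
      C * (ell z * (wt s₁ s₂ x * wt s₁ s₂ y) + ell y * (wt s₁ s₂ x * wt s₁ s₂ z)
        + ell x * (wt s₁ s₂ y * wt s₁ s₂ z)) := by
  refine ⟨(1 + 2 * s₁ * 2 ^ s₁) + (1 + 2 * s₂ * 2 ^ s₂), ?_, ?_⟩
  · have : 1 ≤ s₁ := hs₂.trans hs₁
    positivity
  intro x y z h
  have hre : x.re + y.re + z.re = 0 := by simpa using congrArg Complex.re h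
  have him : x.im + y.im + z.im = 0 := by simpa using congrArg Complex.im h
  set k := 2 * Real.pi
  have hre' : k * x.re + k * y.re + k * z.re = 0 := by rw [← mul_add, ← mul_add, hre, mul_zero]
  have him' : k * x.im + k * y.im + k * z.im = 0 := by rw [← mul_add, ← mul_add, him, mul_zero]
  have h1 := multX (s₁ := s₁) (s₂ := s₂) (hs₂.trans hs₁) (k * x.re, k * x.im) (k * y.re, k * y.im)
    (k * z.re, k * z.im) hre' him'
  have h2 := multY hs₂ hs₁ (k * x.re, k * x.im) (k * y.re, k * y.im)
    (k * z.re, k * z.im) hre' him'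
  simp only at h1 h2
  have e : mlt s₁ s₂ x + mlt s₁ s₂ y + mlt s₁ s₂ z =
    (k * x.re + k * y.re + k * z.re) +
    (k * x.re * (br (k * x.re) ^ s₁) ^ 2 + k * y.re * (br (k * y.re) ^ s₁) ^ 2 + k * z.re * (br (k * z.re) ^ s₁) ^ 2) +
    (k * x.re * (br (k * x.im) ^ s₂) ^ 2 + k * y.re * (br (k * y.im) ^ s₂) ^ 2 + k * z.re * (br (k * z.im) ^ s₂) ^ 2) := by
    simp only [mlt, w2]; ring
  rw [e, hre', zero_add, add_mul]
  exact (abs_add_le _ _).trans (add_le_add h1 h2)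

/-- the cyclic map `(x,y) ↦ (y,-x-y)`. -/
def tau (p : ℂ × ℂ) : ℂ × ℂ := (p.2, -p.1 - p.2)

lemma tau_mp : MeasurePreserving tau (volume : Measure (ℂ × ℂ)) volume := by
  have h1 : MeasurePreserving (Prod.swap : ℂ × ℂ → ℂ × ℂ) (volume.prod volume) (volume.prod volume) :=
    Measure.measurePreserving_swap
  have h2 : MeasurePreserving (fun p : ℂ × ℂ => (p.1, p.1 + p.2)) (volume.prod volume) (volume.prod volume) :=
    measurePreserving_prod_add volume volume
  have h3 : MeasurePreserving (Prod.map id (fun z => -z) : ℂ × ℂ → ℂ × ℂ) (volume.prod volume) (volume.prod volume) :=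
    (MeasurePreserving.id _).prod (Measure.measurePreserving_neg volume)
  have h := h3.comp (h2.comp h1)
  have e : tau = (Prod.map id fun z => -z) ∘ (fun p : ℂ × ℂ => (p.1, p.1 + p.2)) ∘ Prod.swap := by
    funext p
    refine Prod.ext rfl ?_
    simp only [tau, Function.comp, Prod.map, Prod.swap]; ring
  rw [e]; exact h

lemma swap_mp : MeasurePreserving (Prod.swap : ℂ × ℂ → ℂ × ℂ) (volume : Measure (ℂ × ℂ)) volume :=
  Measure.measurePreserving_swap

lemma mp_integral {E : Type*} [NormedAddCommGroup E] [NormedSpace ℝ E] {t : ℂ × ℂ → ℂ × ℂ}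
    (ht : MeasurePreserving t (volume : Measure (ℂ × ℂ)) volume)
    {f : ℂ × ℂ → E} (hf : AEStronglyMeasurable f volume) : ∫ p, f (t p) = ∫ p, f p := by
  have := integral_map (μ := (volume : Measure (ℂ × ℂ))) ht.measurable.aemeasurable (f := f) (by rw [ht.map_eq]; exact hf)
  rw [ht.map_eq] at this
  exact this.symm

lemma trilin {F : ℂ → ℂ} {m l w : ℂ → ℝ} {C M : ℝ} (hC : 0 < C)
    (hF : Continuous F) (hM : ∀ z, ‖F z‖ ≤ M)
    (hl0 : ∀ z, 0 ≤ l z)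
    (iF : Integrable F) (imF : Integrable (fun z => (m z : ℂ) * F z))
    (ilF : Integrable (fun z => l z * ‖F z‖)) (iwF : Integrable (fun z => (w z * ‖F z‖) ^ 2))
    (hb : ∀ x y z : ℂ, x + y + z = 0 → |m x + m y + m z| ≤
      C * (l z * (w x * w y) + l y * (w x * w z) + l x * (w y * w z))) :
    Integrable (fun p : ℂ × ℂ => (m p.1 : ℂ) * F p.1 * (F p.2 * F (-p.1 - p.2))) ∧
    ‖∫ p : ℂ × ℂ, (m p.1 : ℂ) * F p.1 * (F p.2 * F (-p.1 - p.2))‖ ≤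
      C * ((∫ z, l z * ‖F z‖) * ∫ z, (w z * ‖F z‖) ^ 2) := by
  set Φ : ℂ × ℂ → ℂ := fun p => (m p.1 : ℂ) * F p.1 * (F p.2 * F (-p.1 - p.2)) with hΦ
  have iΦ : Integrable Φ := by
    have h1 : Integrable (fun p : ℂ × ℂ => ((m p.1 : ℂ) * F p.1) * F p.2) (volume.prod volume) := imF.mul_prod iF
    have h2 := h1.mul_bdd (c := M) (g := fun p : ℂ × ℂ => F (-p.1 - p.2)) (by
      apply Continuous.aestronglyMeasurable; fun_prop) (Filter.Eventually.of_forall fun p => hM _)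
    refine h2.congr (Filter.Eventually.of_forall fun p => ?_)
    simp only [hΦ]; ring
  refine ⟨iΦ, ?_⟩
  have tau2 := tau_mp.comp tau_mp
  have i2 : Integrable (fun p => Φ (tau p)) := tau_mp.integrable_comp_of_integrable iΦ
  have i3 : Integrable (fun p => Φ (tau (tau p))) := tau2.integrable_comp_of_integrable iΦ
  have e2 := mp_integral tau_mp iΦ.1
  have e3 : ∫ p, Φ (tau (tau p)) = ∫ p, Φ p := mp_integral tau2 iΦ.1
  have esum : 3 * ∫ p, Φ p = ∫ p, (Φ p + Φ (tau p) + Φ (tau (tau p))) := by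
    have := integral_add (iΦ.add i2) i3
    simp only [Pi.add_apply] at this
    rw [this, integral_add iΦ i2, e2, e3]; ring
  -- majorant
  set G : ℂ × ℂ → ℝ := fun p => (l p.1 * ‖F p.1‖) * (w p.2 * ‖F p.2‖) ^ 2 with hG
  set L := ∫ z, l z * ‖F z‖
  set A := ∫ z, (w z * ‖F z‖) ^ 2
  have iG : Integrable G := Integrable.mul_prod ilF iwF
  have eG : ∫ p, G p = L * A := integral_prod_mul (fun z => l z * ‖F z‖) (fun z => (w z * ‖F z‖) ^ 2)
  have key : ∀ t : ℂ × ℂ → ℂ × ℂ, MeasurePreserving t (volume : Measure (ℂ × ℂ)) volume →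
      Integrable (fun p => G (t p)) ∧ ∫ p, G (t p) = L * A := fun t ht =>
    ⟨ht.integrable_comp_of_integrable iG, (mp_integral ht iG.1).trans eG⟩
  obtain ⟨j1, k1⟩ := key id (MeasurePreserving.id _)
  obtain ⟨j2, k2⟩ := key tau tau_mp
  obtain ⟨j3, k3⟩ := key _ tau2
  obtain ⟨j4, k4⟩ := key _ swap_mp
  obtain ⟨j5, k5⟩ := key _ (swap_mp.comp tau_mp)
  obtain ⟨j6, k6⟩ := key _ (swap_mp.comp tau2)
  have bound : ∀ p, ‖Φ p + Φ (tau p) + Φ (tau (tau p))‖ ≤ (C / 2) *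
      (G (id p) + G (tau p) + G ((tau ∘ tau) p) + G (Prod.swap p) + G ((Prod.swap ∘ tau) p)
        + G ((Prod.swap ∘ tau ∘ tau) p)) := by
    rintro ⟨x, y⟩
    obtain ⟨z, hz⟩ : ∃ z, z = -x - y := ⟨_, rfl⟩
    have hxyz : x + y + z = 0 := by rw [hz]; ring
    have t1 : tau (x, y) = (y, z) := by simp [tau, hz]
    have t2 : tau (y, z) = (z, x) := by
      have : -y - z = x := by rw [hz]; ring
      simp [tau, this]
    have f1 : Φ (x, y) = (m x : ℂ) * (F x * F y * F z) := by simp only [hΦ, hz]; ring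
    have f2 : Φ (y, z) = (m y : ℂ) * (F x * F y * F z) := by
      have : -y - z = x := by rw [hz]; ring
      simp only [hΦ, this]; ring
    have f3 : Φ (z, x) = (m z : ℂ) * (F x * F y * F z) := by
      have : -z - x = y := by rw [hz]; ring
      simp only [hΦ, this]; ring
    simp only [Function.comp, t1, t2, id, Prod.swap_prod_mk, f1, f2, f3]
    rw [← add_mul, ← add_mul, norm_mul, norm_mul, norm_mul, ← Complex.ofReal_add, ← Complex.ofReal_add,
      Complex.norm_real, Real.norm_eq_abs]
    have hbb := hb x y z hxyz
    simp only [hG]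
    have a1 := norm_nonneg (F x)
    have a2 := norm_nonneg (F y)
    have a3 := norm_nonneg (F z)
    have := mul_le_mul_of_nonneg_right hbb (by positivity : 0 ≤ ‖F x‖ * ‖F y‖ * ‖F z‖)
    refine this.trans ?_
    have g1 := mul_nonneg (mul_nonneg (hl0 z) a3) (sq_nonneg (w x * ‖F x‖ - w y * ‖F y‖))
    have g2 := mul_nonneg (mul_nonneg (hl0 y) a2) (sq_nonneg (w x * ‖F x‖ - w z * ‖F z‖))
    have g3 := mul_nonneg (mul_nonneg (hl0 x) a1) (sq_nonneg (w y * ‖F y‖ - w z * ‖F z‖))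
    have g := mul_nonneg (half_pos hC).le (add_nonneg (add_nonneg g1 g2) g3)
    refine le_of_sub_nonneg (g.trans_eq ?_)
    ring
  have h3 : 3 * ‖∫ p, Φ p‖ ≤ 3 * (C * (L * A)) := by
    have e : 3 * ‖∫ p, Φ p‖ = ‖∫ p, (Φ p + Φ (tau p) + Φ (tau (tau p)))‖ := by
      rw [← esum, norm_mul]; simp
    rw [e]
    refine (norm_integral_le_of_norm_le
      ((((((j1.add j2).add j3).add j4).add j5).add j6).const_mul (C / 2)) (Filter.Eventually.of_forall bound)).trans ?_
    rw [integral_const_mul]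
    rw [integral_add' ((((j1.add j2).add j3).add j4).add j5) j6,
      integral_add' (((j1.add j2).add j3).add j4) j5, integral_add' ((j1.add j2).add j3) j4, integral_add' (j1.add j2) j3,
      integral_add' j1 j2, k1, k2, k3, k4, k5, k6]
    apply le_of_eq; ring
  linarith

lemma ell_w2_integrable {s₁ s₂ : ℝ} (hs₂ : 2 < s₂) (hs₁ : s₂ ≤ s₁) :
    Integrable (fun z : ℂ => ell z ^ 2 / w2 s₁ s₂ z) := by
  have hI : Integrable (fun z : ℂ => ((1 : ℝ) + ‖z‖ ^ 2) ^ (-(2 * (s₂ - 1)) / 2)) :=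
    integrable_rpow_neg_one_add_norm_sq (by rw [Complex.finrank_real_complex]; push_cast; linarith)
  obtain ⟨k, hk⟩ : ∃ k, k = 2 * Real.pi := ⟨_, rfl⟩
  have hk1 : 1 ≤ k := by have := Real.pi_gt_three; rw [hk]; linarith
  refine (hI.const_mul (2 * k ^ 2 * 2 ^ s₂)).mono' ?_ (Filter.Eventually.of_forall fun z => ?_)
  · apply Continuous.aestronglyMeasurable
    exact (ell_cont.pow 2).div₀ (w2_cont _ _) (fun z => (lt_of_lt_of_le one_pos (w2_one_le s₁ s₂ z)).ne')
  have hw := lt_of_lt_of_le one_pos (w2_one_le s₁ s₂ z)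
  rw [Real.norm_of_nonneg (by positivity)]
  set R := 1 + ‖z‖ ^ 2 with hR
  have hRpos : 0 < R := by positivity
  have hn : ‖z‖ ^ 2 = z.re ^ 2 + z.im ^ 2 := by
    rw [← Complex.normSq_eq_norm_sq, Complex.normSq_apply]; ring
  have h1 : ell z ^ 2 ≤ 2 * k ^ 2 * R := by
    unfold ell
    rw [← hk]
    have e1 := sq_abs (k * z.re)
    have e2 := sq_abs (k * z.im)
    have := sq_nonneg (|k * z.re| - |k * z.im|)
    rw [hR, hn]
    nlinarith [sq_nonneg k]
  have sqr : ∀ t s : ℝ, (br t ^ s) ^ 2 = (br t ^ 2) ^ s := by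
    intro t s
    rw [← Real.rpow_natCast, ← Real.rpow_mul (br_pos t).le, ← Real.rpow_natCast (br t), ← Real.rpow_mul (br_pos t).le, mul_comm]
  have h2 : R ^ s₂ ≤ 2 ^ s₂ * w2 s₁ s₂ z := by
    have hkk : 1 ≤ k ^ 2 := one_le_pow₀ hk1
    have hmax : R ≤ 2 * max (br (k * z.re) ^ 2) (br (k * z.im) ^ 2) := by
      rw [br_sq, br_sq, hR, hn, mul_pow, mul_pow]
      have := le_max_left (1 + k ^ 2 * z.re ^ 2) (1 + k ^ 2 * z.im ^ 2)
      have := le_max_right (1 + k ^ 2 * z.re ^ 2) (1 + k ^ 2 * z.im ^ 2)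
      nlinarith [mul_le_mul_of_nonneg_right hkk (sq_nonneg z.re), mul_le_mul_of_nonneg_right hkk (sq_nonneg z.im)]
    have hm0 : 0 ≤ max (br (k * z.re) ^ 2) (br (k * z.im) ^ 2) := le_max_of_le_left (sq_nonneg _)
    calc R ^ s₂ ≤ (2 * max (br (k * z.re) ^ 2) (br (k * z.im) ^ 2)) ^ s₂ :=
          Real.rpow_le_rpow hRpos.le hmax (by linarith)
      _ = 2 ^ s₂ * max (br (k * z.re) ^ 2) (br (k * z.im) ^ 2) ^ s₂ := Real.mul_rpow (by norm_num) hm0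
      _ ≤ _ := by
        gcongr
        unfold w2
        rw [← hk]
        rcases max_choice (br (k * z.re) ^ 2) (br (k * z.im) ^ 2) with h | h <;> rw [h, ← sqr]
        · have : br (k * z.re) ^ s₂ ≤ br (k * z.re) ^ s₁ := Real.rpow_le_rpow_of_exponent_le (one_le_br _) hs₁
          have h0 := Real.rpow_pos_of_pos (br_pos (k * z.re)) s₂
          have := pow_le_pow_left₀ h0.le this 2
          nlinarith [sq_nonneg (br (k * z.im) ^ s₂)]
        · nlinarith [sq_nonneg (br (k * z.re) ^ s₁)]
  have e : R ^ (-(2 * (s₂ - 1)) / 2) = R / R ^ s₂ := by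
    rw [show -(2 * (s₂ - 1)) / 2 = 1 - s₂ by ring, Real.rpow_sub hRpos, Real.rpow_one]
  have hRs := Real.rpow_pos_of_pos hRpos s₂
  rw [e, div_le_iff₀ hw]
  have h3 : 1 ≤ 2 ^ s₂ / R ^ s₂ * w2 s₁ s₂ z := by
    rw [div_mul_eq_mul_div, le_div_iff₀ hRs]; linarith
  calc ell z ^ 2 ≤ 2 * k ^ 2 * R * 1 := by linarith
    _ ≤ 2 * k ^ 2 * R * (2 ^ s₂ / R ^ s₂ * w2 s₁ s₂ z) := by gcongr
    _ = _ := by ring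

lemma L1_bound {s₁ s₂ : ℝ} (hs₂ : 2 < s₂) (hs₁ : s₂ ≤ s₁) : ∃ K : ℝ, 0 < K ∧
    ∀ F : ℂ → ℂ, Integrable (fun z => w2 s₁ s₂ z * ‖F z‖ ^ 2) →
      Integrable (fun z => ell z * ‖F z‖) →
      ∀ N : ℝ, 0 ≤ N → ∫ z, w2 s₁ s₂ z * ‖F z‖ ^ 2 = N ^ 2 → ∫ z, ell z * ‖F z‖ ≤ K * N := by
  have hI := ell_w2_integrable hs₂ hs₁
  set K0 := ∫ z, ell z ^ 2 / w2 s₁ s₂ z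
  have hK0 : 0 ≤ K0 := integral_nonneg fun z => by
    have hw := lt_of_lt_of_le one_pos (w2_one_le s₁ s₂ z)
    positivity
  refine ⟨K0 + 1, by linarith, fun F h1 h2 N hN hNe => ?_⟩
  have main : ∀ t : ℝ, 0 < t → N ≤ t → ∫ z, ell z * ‖F z‖ ≤ (K0 + 1) * t := by
    intro t ht hNt
    have hle : ∀ z, ell z * ‖F z‖ ≤ t * (ell z ^ 2 / w2 s₁ s₂ z) + t⁻¹ * (w2 s₁ s₂ z * ‖F z‖ ^ 2) := by
      intro z
      have hw := lt_of_lt_of_le one_pos (w2_one_le s₁ s₂ z)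
      have hl := ell_nonneg z
      have h0 : 0 ≤ ell z * ‖F z‖ := by positivity
      have : 0 ≤ (t * ell z - w2 s₁ s₂ z * ‖F z‖) ^ 2 / (t * w2 s₁ s₂ z) := by positivity
      have e : (t * ell z - w2 s₁ s₂ z * ‖F z‖) ^ 2 / (t * w2 s₁ s₂ z) =
        t * (ell z ^ 2 / w2 s₁ s₂ z) + t⁻¹ * (w2 s₁ s₂ z * ‖F z‖ ^ 2) - 2 * (ell z * ‖F z‖) := by
        field_simp; ring
      linarith
    have := integral_mono h2 ((hI.const_mul t).add (h1.const_mul t⁻¹)) hle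
    rw [integral_add' (hI.const_mul t) (h1.const_mul t⁻¹), integral_const_mul, integral_const_mul, hNe] at this
    have h3 : t⁻¹ * N ^ 2 ≤ t := by
      rw [inv_mul_le_iff₀ ht]; nlinarith
    change _ ≤ t * K0 + _ at this
    nlinarith
  refine le_of_forall_pos_le_add fun ε hε => ?_
  have := main (N + ε / (K0 + 1)) (by positivity) (by have : 0 < ε / (K0 + 1) := by positivity
                                                      linarith)
  refine this.trans_eq ?_
  field_simp

open scoped FourierTransform SchwartzMap LineDeriv

/-- transfer a function on `ℂ` to `ℝ × ℝ` -/
def lft (v : ℂ → ℂ) (p : ℝ × ℝ) : ℂ := v ⟨p.1, p.2⟩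

lemma int_prod {E : Type*} [NormedAddCommGroup E] [NormedSpace ℝ E] (f : ℝ × ℝ → E) :
    ∫ p, f p = ∫ z : ℂ, f (z.re, z.im) :=
  (Complex.volume_preserving_equiv_real_prod.integral_comp' f).symm

lemma inner_C (z w : ℂ) : inner ℝ z w = z.re * w.re + z.im * w.im := by
  rw [Complex.inner]; simp; ring

lemma FT2_lft (v : 𝓢(ℂ, ℂ)) (q : ℝ × ℝ) :
    FT2 (lft v) q = 𝓕 v ⟨q.1 / (2 * Real.pi), q.2 / (2 * Real.pi)⟩ := by
  rw [SchwartzMap.fourier_coe, Real.fourier_eq', FT2, int_prod]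
  congr 1
  funext z
  simp only [lft, smul_eq_mul, inner_C]
  congr 2
  have : (Real.pi : ℂ) ≠ 0 := by exact_mod_cast Real.pi_ne_zero
  push_cast
  field_simp

lemma J_lft (m : ℝ × ℝ → ℝ) (g : ℂ → ℝ) (hg : g.HasTemperateGrowth)
    (hmg : ∀ z : ℂ, m (2 * Real.pi * z.re, 2 * Real.pi * z.im) = g z) (v : 𝓢(ℂ, ℂ)) (p : ℝ × ℝ) :
    ((1 / (2 * Real.pi) ^ 2 : ℝ) : ℂ) *
    ∫ q : ℝ × ℝ, Complex.exp (Complex.I * ((p.1 : ℂ) * (q.1 : ℂ) + (p.2 : ℂ) * (q.2 : ℂ))) *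
      (m q : ℂ) * FT2 (lft v) q = lft (𝓕⁻ (SchwartzMap.smulLeftCLM ℂ g (𝓕 v)) : 𝓢(ℂ, ℂ)) p := by
  have hpi : (Real.pi : ℂ) ≠ 0 := by exact_mod_cast Real.pi_ne_zero
  rw [int_prod]
  simp only [FT2_lft]
  unfold lft
  rw [SchwartzMap.fourierInv_coe, Real.fourierInv_eq']
  have h := Measure.integral_comp_smul (volume : Measure ℂ) (fun z : ℂ =>
    Complex.exp (Complex.I * ((p.1 : ℂ) * (z.re : ℂ) + (p.2 : ℂ) * (z.im : ℂ))) *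
      (m (z.re, z.im) : ℂ) * 𝓕 v ⟨z.re / (2 * Real.pi), z.im / (2 * Real.pi)⟩) (2 * Real.pi)
  rw [Complex.finrank_real_complex, abs_of_pos (by positivity)] at h
  rw [one_div, ← Complex.real_smul, ← h]
  congr 1
  funext z
  have e : (⟨(2 * Real.pi) * z.re / (2 * Real.pi), (2 * Real.pi) * z.im / (2 * Real.pi)⟩ : ℂ) = z := by
    apply Complex.ext <;> simp only <;> field_simp
  simp only [Complex.smul_re, Complex.smul_im, smul_eq_mul, hmg, e, inner_C,
    SchwartzMap.smulLeftCLM_apply_apply hg]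
  simp only [Complex.real_smul]
  rw [mul_assoc]
  congr 2
  push_cast
  ring

lemma temp_br (s : ℝ) : (fun t : ℝ => br t ^ s).HasTemperateGrowth := by
  have := Function.hasTemperateGrowth_one_add_norm_sq_rpow ℝ (s / 2)
  have e : (fun t : ℝ => br t ^ s) = fun x : ℝ => (1 + ‖x‖ ^ 2) ^ (s / 2) := by
    funext t
    rw [br_rpow]; simp
  rw [e]; exact this

noncomputable def gx (s : ℝ) (z : ℂ) : ℝ := br (2 * Real.pi * z.re) ^ s
noncomputable def gy (s : ℝ) (z : ℂ) : ℝ := br (2 * Real.pi * z.im) ^ s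

lemma temp_gx (s : ℝ) : (gx s).HasTemperateGrowth :=
  (temp_br s).comp (((2 * Real.pi) • Complex.reCLM).hasTemperateGrowth)

lemma temp_gy (s : ℝ) : (gy s).HasTemperateGrowth :=
  (temp_br s).comp (((2 * Real.pi) • Complex.imCLM).hasTemperateGrowth)

lemma Jx_lft (s : ℝ) (v : 𝓢(ℂ, ℂ)) :
    Jx s (lft v) = lft (𝓕⁻ (SchwartzMap.smulLeftCLM ℂ (gx s) (𝓕 v)) : 𝓢(ℂ, ℂ)) := by
  funext p
  exact J_lft (fun q => (1 + q.1 ^ 2) ^ (s / 2)) (gx s) (temp_gx s) (fun z => by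
    simp only [gx, br_rpow]) v p

lemma Jy_lft (s : ℝ) (v : 𝓢(ℂ, ℂ)) :
    Jy s (lft v) = lft (𝓕⁻ (SchwartzMap.smulLeftCLM ℂ (gy s) (𝓕 v)) : 𝓢(ℂ, ℂ)) := by
  funext p
  exact J_lft (fun q => (1 + q.2 ^ 2) ^ (s / 2)) (gy s) (temp_gy s) (fun z => by
    simp only [gy, br_rpow]) v p

lemma IP2_lft (f g : 𝓢(ℂ, ℂ)) : IP2 (lft f) (lft g) = ∫ z, (starRingEnd ℂ) (𝓕 f z) * 𝓕 g z := by
  have := SchwartzMap.integral_inner_fourier_fourier f g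
  simp only [RCLike.inner_apply] at this
  rw [IP2, int_prod]
  simp only [lft]
  simp only [mul_comm (_ : ℂ) ((starRingEnd ℂ) _)] at this
  exact this.symm

lemma L2_lft (f : 𝓢(ℂ, ℂ)) : L2norm2 (lft f) ^ 2 = ∫ z, ‖𝓕 f z‖ ^ 2 := by
  rw [SchwartzMap.integral_norm_sq_fourier, L2norm2, int_prod, ← Real.rpow_natCast, ← Real.rpow_mul]
  · simp [lft]
  · exact integral_nonneg fun _ => by positivity

lemma int_norm_mul (f g : 𝓢(ℂ, ℂ)) {m : ℂ → ℝ} (hm : m.HasTemperateGrowth) :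
    Integrable (fun z => m z * (‖f z‖ * ‖g z‖)) := by
  have h1 : Integrable (fun z => ‖SchwartzMap.smulLeftCLM ℂ m f z‖) := (SchwartzMap.smulLeftCLM ℂ m f).integrable.norm
  obtain ⟨M, hM⟩ : ∃ M, ∀ z, ‖g z‖ ≤ M := ⟨_, fun z => SchwartzMap.norm_le_seminorm ℝ g z⟩
  have h2 := h1.mul_bdd (c := M) (g := fun z => ‖g z‖) (by
    exact g.continuous.norm.aestronglyMeasurable) (Filter.Eventually.of_forall fun p => by simpa using hM _)
  refine h2.mono ?_ (Filter.Eventually.of_forall fun p => ?_)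
  · have := hm.1.continuous
    exact (this.mul (f.continuous.norm.mul g.continuous.norm)).aestronglyMeasurable
  · simp [SchwartzMap.smulLeftCLM_apply_apply hm, mul_assoc]

lemma temp_w2 (s₁ s₂ : ℝ) : (w2 s₁ s₂).HasTemperateGrowth :=
  ((Function.HasTemperateGrowth.const 1).add ((temp_gx s₁).pow 2)).add ((temp_gy s₂).pow 2)

lemma fourier_mul_eq (v w : 𝓢(ℂ, ℂ)) (z : ℂ) :
    𝓕 (SchwartzMap.pairing (ContinuousLinearMap.mul ℂ ℂ) v w) z = ∫ r, 𝓕 v r * 𝓕 w (z - r) := by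
  have h := SchwartzMap.convolution_apply (ContinuousLinearMap.mul ℂ ℂ) (𝓕 v) (𝓕 w) z
  have e : SchwartzMap.convolution (ContinuousLinearMap.mul ℂ ℂ) (𝓕 v) (𝓕 w) =
      𝓕 (SchwartzMap.pairing (ContinuousLinearMap.mul ℂ ℂ) v w) := by
    change 𝓕⁻ (SchwartzMap.pairing (ContinuousLinearMap.mul ℂ ℂ) (𝓕 (𝓕 v)) (𝓕 (𝓕 w))) = _
    ext x
    rw [SchwartzMap.fourierInv_coe, SchwartzMap.fourier_coe, Real.fourierInv_eq_fourier_comp_neg]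
    refine congrArg (fun h : ℂ → ℂ => 𝓕 h x) (funext fun y => ?_)
    have key : ∀ u : 𝓢(ℂ, ℂ), 𝓕 (𝓕 u) (-y) = u y := by
      intro u
      have h1 : 𝓕⁻ (𝓕 u) y = u y := by simp
      rw [← h1, SchwartzMap.fourierInv_coe, Real.fourierInv_eq_fourier_neg, SchwartzMap.fourier_coe (𝓕 u)]
    simp [SchwartzMap.pairing_apply_apply, key]
  rw [← e, h]
  simp [convolution]

lemma fourier_g (v : 𝓢(ℂ, ℂ)) (z : ℂ) :
    𝓕 ((1 / 2 : ℂ) • ∂_{(1 : ℂ)} (SchwartzMap.pairing (ContinuousLinearMap.mul ℂ ℂ) v v)) z =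
      Complex.I * (Real.pi : ℂ) * z.re * ∫ r, 𝓕 v r * 𝓕 v (z - r) := by
  have ht : (fun x : ℂ => inner ℝ x (1 : ℂ)).HasTemperateGrowth := by fun_prop
  rw [FourierTransform.fourier_smul, SchwartzMap.fourier_lineDerivOp_eq, ← fourier_mul_eq]
  rw [_root_.smul_apply, _root_.smul_apply, SchwartzMap.smulLeftCLM_apply_apply ht, inner_C]
  simp
  ring

/-- complex version of a real Schwartz function, on `ℂ` -/
noncomputable def cpx (u : 𝓢(ℝ × ℝ, ℝ)) : 𝓢(ℂ, ℂ) :=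
  (SchwartzMap.compCLMOfContinuousLinearEquiv ℝ Complex.equivRealProdCLM u).postcompCLM
    Complex.ofRealCLM

lemma cpx_apply (u : 𝓢(ℝ × ℝ, ℝ)) (z : ℂ) : cpx u z = (u (z.re, z.im) : ℂ) := rfl

lemma cpx_lft (u : 𝓢(ℝ × ℝ, ℝ)) : (fun p => ((u p : ℝ) : ℂ)) = lft (cpx u) := rfl

/-- the Schwartz function corresponding to the nonlinearity -/
noncomputable def nlin (v : 𝓢(ℂ, ℂ)) : 𝓢(ℂ, ℂ) :=
  (1 / 2 : ℂ) • ∂_{(1 : ℂ)} (SchwartzMap.pairing (ContinuousLinearMap.mul ℂ ℂ) v v)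

lemma nlin_lft (u : 𝓢(ℝ × ℝ, ℝ)) :
    (fun p => (((u p * fderiv ℝ (⇑u) p (1, 0) : ℝ)) : ℂ)) = lft (nlin (cpx u)) := by
  funext p
  obtain ⟨a, b⟩ := p
  have h0 : HasFDerivAt u (fderiv ℝ u (a, b)) (Complex.equivRealProdCLM (⟨a, b⟩ : ℂ)) :=
    u.differentiableAt.hasFDerivAt
  have h1 : HasFDerivAt (fun z : ℂ => (u (Complex.equivRealProdCLM z)))
      ((fderiv ℝ u (a, b)).comp (Complex.equivRealProdCLM : ℂ →L[ℝ] ℝ × ℝ)) (⟨a, b⟩ : ℂ) :=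
    h0.comp _ Complex.equivRealProdCLM.hasFDerivAt
  have h2 := (h1.mul h1)
  have h3 := Complex.ofRealCLM.hasFDerivAt.comp (⟨a, b⟩ : ℂ) h2
  have e : ⇑(SchwartzMap.pairing (ContinuousLinearMap.mul ℂ ℂ) (cpx u) (cpx u)) =
      Complex.ofRealCLM ∘ ((fun z : ℂ => (u (Complex.equivRealProdCLM z))) * (fun z : ℂ => (u (Complex.equivRealProdCLM z)))) := by
    funext z
    simp [cpx_apply]
  simp only [lft, nlin]
  rw [_root_.smul_apply, SchwartzMap.lineDerivOp_apply_eq_fderiv, e, h3.fderiv]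
  simp
  ring

lemma conj_fourier (u : 𝓢(ℝ × ℝ, ℝ)) (z : ℂ) :
    (starRingEnd ℂ) (𝓕 (cpx u) z) = 𝓕 (cpx u) (-z) := by
  rw [SchwartzMap.fourier_coe, Real.fourier_eq', Real.fourier_eq', ← integral_conj]
  congr 1
  funext w
  simp only [smul_eq_mul, map_mul, cpx_apply, Complex.conj_ofReal, ← Complex.exp_conj, Complex.conj_I,
    inner_neg_right]
  congr 2
  push_cast
  ring

lemma IP_mult {g : ℂ → ℝ} (hg : g.HasTemperateGrowth) (f h : 𝓢(ℂ, ℂ)) :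
    IP2 (lft (𝓕⁻ (SchwartzMap.smulLeftCLM ℂ g (𝓕 f)) : 𝓢(ℂ, ℂ)))
      (lft (𝓕⁻ (SchwartzMap.smulLeftCLM ℂ g (𝓕 h)) : 𝓢(ℂ, ℂ))) =
    ∫ z, ((g z ^ 2 : ℝ) : ℂ) * ((starRingEnd ℂ) (𝓕 f z) * 𝓕 h z) := by
  rw [IP2_lft]
  congr 1
  funext z
  simp only [FourierTransform.fourier_fourierInv_eq, SchwartzMap.smulLeftCLM_apply_apply hg, Complex.real_smul, map_mul,
    Complex.conj_ofReal]
  push_cast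
  ring

lemma L2_mult {g : ℂ → ℝ} (hg : g.HasTemperateGrowth) (f : 𝓢(ℂ, ℂ)) :
    L2norm2 (lft (𝓕⁻ (SchwartzMap.smulLeftCLM ℂ g (𝓕 f)) : 𝓢(ℂ, ℂ))) ^ 2 =
    ∫ z, g z ^ 2 * ‖𝓕 f z‖ ^ 2 := by
  rw [L2_lft]
  congr 1
  funext z
  simp only [FourierTransform.fourier_fourierInv_eq, SchwartzMap.smulLeftCLM_apply_apply hg, norm_smul, mul_pow,
    Real.norm_eq_abs, sq_abs]

lemma int_conj_mul (f h : 𝓢(ℂ, ℂ)) {m : ℂ → ℝ} (hm : m.HasTemperateGrowth) :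
    Integrable (fun z => (m z : ℂ) * ((starRingEnd ℂ) (f z) * h z)) := by
  refine (int_norm_mul f h hm).mono ?_ (Filter.Eventually.of_forall fun p => ?_)
  · have := hm.1.continuous
    exact ((Complex.continuous_ofReal.comp this).mul
      ((Complex.continuous_conj.comp f.continuous).mul h.continuous)).aestronglyMeasurable
  · simp

lemma int_sq (f : 𝓢(ℂ, ℂ)) {m : ℂ → ℝ} (hm : m.HasTemperateGrowth) :
    Integrable (fun z => m z * ‖f z‖ ^ 2) := by
  simpa only [sq] using int_norm_mul f f hm

lemma int_abs_mul (f : 𝓢(ℂ, ℂ)) {m : ℂ → ℝ} (hm : m.HasTemperateGrowth) :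
    Integrable (fun z => |m z| * ‖f z‖) := by
  have h1 := (SchwartzMap.smulLeftCLM ℂ m f).integrable (μ := volume) |>.norm
  simpa only [SchwartzMap.smulLeftCLM_apply_apply hm, norm_smul, Real.norm_eq_abs] using h1

lemma temp_re : (fun z : ℂ => 2 * Real.pi * z.re).HasTemperateGrowth :=
  ((2 * Real.pi) • Complex.reCLM).hasTemperateGrowth
lemma temp_im : (fun z : ℂ => 2 * Real.pi * z.im).HasTemperateGrowth :=
  ((2 * Real.pi) • Complex.imCLM).hasTemperateGrowth

lemma temp_mlt (s₁ s₂ : ℝ) : (mlt s₁ s₂).HasTemperateGrowth := temp_re.mul (temp_w2 s₁ s₂)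

lemma aniso_nonneg (s₁ s₂ : ℝ) (f : ℝ × ℝ → ℂ) : 0 ≤ anisoNorm s₁ s₂ f := by
  unfold anisoNorm; positivity

lemma aniso_sq (s₁ s₂ : ℝ) (f : 𝓢(ℂ, ℂ)) :
    ∫ z, w2 s₁ s₂ z * ‖𝓕 f z‖ ^ 2 = anisoNorm s₁ s₂ (lft f) ^ 2 := by
  have h1 : Integrable (fun z => 1 * ‖𝓕 f z‖ ^ 2) := int_sq (𝓕 f) (Function.HasTemperateGrowth.const 1)
  have h2 := int_sq (𝓕 f) ((temp_gx s₁).pow 2)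
  have h3 := int_sq (𝓕 f) ((temp_gy s₂).pow 2)
  rw [anisoNorm, ← Real.rpow_natCast, ← Real.rpow_mul (by positivity)]
  norm_num
  rw [Jx_lft, Jy_lft, L2_mult (temp_gx s₁), L2_mult (temp_gy s₂), L2_lft]
  simp only [one_mul, Pi.pow_apply] at h1 h2 h3
  have h12 := h1.add h2
  rw [← integral_add h1 h2]
  refine Eq.trans ?_ (integral_add h12 h3)
  congr 1
  funext z
  simp only [w2, gx, gy, Pi.add_apply]
  ring

lemma energy_eq (s₁ s₂ : ℝ) (f h : 𝓢(ℂ, ℂ)) :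
    IP2 (lft f) (lft h) + IP2 (Jx s₁ (lft f)) (Jx s₁ (lft h)) + IP2 (Jy s₂ (lft f)) (Jy s₂ (lft h))
      = ∫ z, (w2 s₁ s₂ z : ℂ) * ((starRingEnd ℂ) (𝓕 f z) * 𝓕 h z) := by
  have h1 := int_conj_mul (𝓕 f) (𝓕 h) (m := fun _ => 1) (Function.HasTemperateGrowth.const 1)
  have h2 := int_conj_mul (𝓕 f) (𝓕 h) ((temp_gx s₁).pow 2)
  have h3 := int_conj_mul (𝓕 f) (𝓕 h) ((temp_gy s₂).pow 2)
  rw [Jx_lft, Jy_lft, Jx_lft, Jy_lft, IP_mult (temp_gx s₁), IP_mult (temp_gy s₂), IP2_lft]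
  simp only [Complex.ofReal_one, one_mul, Pi.pow_apply] at h1 h2 h3
  have h12 := h1.add h2
  rw [← integral_add h1 h2]
  refine (integral_add h12 h3).symm.trans ?_
  congr 1
  funext z
  simp only [w2, gx, gy, Pi.add_apply]
  push_cast
  ring

lemma energy_tri (s₁ s₂ : ℝ) (u : 𝓢(ℝ × ℝ, ℝ))
    (hI : Integrable (fun p : ℂ × ℂ => (mlt s₁ s₂ p.1 : ℂ) * 𝓕 (cpx u) p.1 *
      (𝓕 (cpx u) p.2 * 𝓕 (cpx u) (-p.1 - p.2)))) :
    ∫ z, (w2 s₁ s₂ z : ℂ) * ((starRingEnd ℂ) (𝓕 (cpx u) z) * 𝓕 (nlin (cpx u)) z) =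
    (-(Complex.I / 2)) * ∫ p : ℂ × ℂ, (mlt s₁ s₂ p.1 : ℂ) * 𝓕 (cpx u) p.1 *
      (𝓕 (cpx u) p.2 * 𝓕 (cpx u) (-p.1 - p.2)) := by
  have e := integral_prod (μ := (volume : Measure ℂ)) (ν := (volume : Measure ℂ)) _ hI
  rw [Measure.volume_eq_prod, e, ← integral_const_mul,
    ← integral_neg_eq_self (fun z : ℂ => (w2 s₁ s₂ z : ℂ) *
      ((starRingEnd ℂ) (𝓕 (cpx u) z) * 𝓕 (nlin (cpx u)) z))]
  congr 1
  funext z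
  simp only [integral_const_mul]
  rw [conj_fourier, w2_neg, nlin, fourier_g, neg_neg]
  simp only [mlt, Complex.neg_re]
  push_cast
  ring

/-- Energy estimate for the BO–ZK nonlinearity: for `s₂ > 2`, `s₁ ≥ s₂` there is `c > 0`
such that for every real-valued Schwartz `u` on `ℝ²`,
`|⟨u, u∂ₓu⟩ + ⟨J_x^{s₁}u, J_x^{s₁}(u∂ₓu)⟩ + ⟨J_y^{s₂}u, J_y^{s₂}(u∂ₓu)⟩| ≤ c ‖u‖³_{s₁,s₂}`. -/
theorem energy_estimate_nonlinearity (s₁ s₂ : ℝ) (hs₂ : 2 < s₂) (hs₁ : s₂ ≤ s₁) :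
    ∃ c : ℝ, 0 < c ∧ ∀ u : SchwartzMap (ℝ × ℝ) ℝ,
      ‖IP2 (fun p => ((u p : ℝ) : ℂ))
            (fun p => (((u p * fderiv ℝ (⇑u) p (1, 0) : ℝ)) : ℂ))
        + IP2 (Jx s₁ (fun p => ((u p : ℝ) : ℂ)))
            (Jx s₁ (fun p => (((u p * fderiv ℝ (⇑u) p (1, 0) : ℝ)) : ℂ)))
        + IP2 (Jy s₂ (fun p => ((u p : ℝ) : ℂ)))
            (Jy s₂ (fun p => (((u p * fderiv ℝ (⇑u) p (1, 0) : ℝ)) : ℂ)))‖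
        ≤ c * anisoNorm s₁ s₂ (fun p => ((u p : ℝ) : ℂ)) ^ 3 := by
  obtain ⟨C, hC, hb⟩ := mlt_bound (by linarith : (1 : ℝ) ≤ s₂) hs₁
  obtain ⟨K, hK, hL⟩ := L1_bound hs₂ hs₁
  refine ⟨C * K, by positivity, fun u => ?_⟩
  rw [cpx_lft, nlin_lft, energy_eq]
  set F : 𝓢(ℂ, ℂ) := 𝓕 (cpx u) with hF
  set N := anisoNorm s₁ s₂ (lft (cpx u)) with hN
  have hN0 : 0 ≤ N := aniso_nonneg _ _ _
  have hNsq : ∫ z, w2 s₁ s₂ z * ‖F z‖ ^ 2 = N ^ 2 := aniso_sq s₁ s₂ (cpx u)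
  have iw2 := int_sq F (temp_w2 s₁ s₂)
  have iell : Integrable (fun z => ell z * ‖F z‖) := by
    refine ((int_abs_mul F temp_re).add (int_abs_mul F temp_im)).congr
      (Filter.Eventually.of_forall fun z => ?_)
    simp only [Pi.add_apply, ell]
    ring
  have iwt : Integrable (fun z => (wt s₁ s₂ z * ‖F z‖) ^ 2) := by
    refine (iw2.const_mul 2).mono' ?_ (Filter.Eventually.of_forall fun z => ?_)
    · exact (((wt_cont s₁ s₂).mul F.continuous.norm).pow 2).aestronglyMeasurable
    · rw [Real.norm_of_nonneg (by positivity), mul_pow, ← mul_assoc]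
      exact mul_le_mul_of_nonneg_right (wt_sq_le s₁ s₂ z) (by positivity)
  have hwt : ∫ z, (wt s₁ s₂ z * ‖F z‖) ^ 2 ≤ 2 * N ^ 2 := by
    rw [← hNsq, ← integral_const_mul]
    refine integral_mono iwt (iw2.const_mul 2) fun z => ?_
    simp only [mul_pow]
    rw [← mul_assoc]
    exact mul_le_mul_of_nonneg_right (wt_sq_le s₁ s₂ z) (by positivity)
  have hell := hL F iw2 iell N hN0 hNsq
  have imF : Integrable (fun z => (mlt s₁ s₂ z : ℂ) * F z) := by
    have h1 := (SchwartzMap.smulLeftCLM ℂ (mlt s₁ s₂) F).integrable (μ := volume)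
    refine h1.congr (Filter.Eventually.of_forall fun z => ?_)
    simp only [SchwartzMap.smulLeftCLM_apply_apply (temp_mlt s₁ s₂), Complex.real_smul]
  obtain ⟨hI, hT⟩ := trilin (F := F) (m := mlt s₁ s₂) (l := ell) (w := wt s₁ s₂) hC F.continuous
    (fun z => SchwartzMap.norm_le_seminorm ℝ F z) ell_nonneg F.integrable imF iell iwt hb
  rw [energy_tri s₁ s₂ u hI, norm_mul]
  have hi : ‖(-(Complex.I / 2))‖ = 1 / 2 := by simp
  rw [hi]
  have h0 : 0 ≤ ∫ z, (wt s₁ s₂ z * ‖F z‖) ^ 2 := integral_nonneg fun z => by positivity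
  have hfin : C * ((∫ z, ell z * ‖F z‖) * ∫ z, (wt s₁ s₂ z * ‖F z‖) ^ 2) ≤
      C * ((K * N) * (2 * N ^ 2)) := by
    gcongr
  calc _ ≤ 1 / 2 * (C * ((K * N) * (2 * N ^ 2))) := by
        gcongr
        exact hT.trans hfin
    _ = C * K * N ^ 3 := by ring
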